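/- arXiv:2204.05402 — 4 statements merged into one kernel-verified Lean document; each statement's English description precedes it below -/
import Mathlib

section
/- For any φ ∈ [0, π) and λ₁, λ₂ > 1, the operator norm of the product P₁ = Z(λ₂) R(φ) Z(λ₁) equals the quantity μ = (a/2)·(1 + c + ((1 + c)² − 4a⁻²)^{1/2}) (with a, b, c as in the factorization lemma), and moreover μ = 1 if and only if a = 1 and b = 0. -/
open Real Matrix

/-- Rotation matrix `R(φ)`. -/
noncomputable def Rot (φ : ℝ) : Matrix (Fin 2) (Fin 2) ℝ :=
  !![Real.cos φ, Real.sin φ; -Real.sin φ, Real.cos φ]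

/-- `Z(λ) = diag{λ, λ⁻¹}`. -/
noncomputable def Zm (l : ℝ) : Matrix (Fin 2) (Fin 2) ℝ := !![l, 0; 0, l⁻¹]

/-- The operator norm on 2×2 real matrices induced by the Euclidean norm on ℝ². -/
noncomputable def opNorm (A : Matrix (Fin 2) (Fin 2) ℝ) : ℝ :=
  ‖Matrix.toEuclideanCLM (𝕜 := ℝ) A‖

/-- `β = (λ₁⁻² + λ₂⁻²)/(1 + λ₁⁻²λ₂⁻²)`. -/
noncomputable def betaQ (l1 l2 : ℝ) : ℝ :=
  ((l1 ^ 2)⁻¹ + (l2 ^ 2)⁻¹) / (1 + (l1 ^ 2)⁻¹ * (l2 ^ 2)⁻¹)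

/-- `a = (λ₁/λ₂)·(λ₂²cos²φ + β sin²φ)/(cos²φ + β² sin²φ)^{1/2}`. -/
noncomputable def aQ (φ l1 l2 : ℝ) : ℝ :=
  (l1 / l2) * (l2 ^ 2 * Real.cos φ ^ 2 + betaQ l1 l2 * Real.sin φ ^ 2) /
    Real.sqrt (Real.cos φ ^ 2 + (betaQ l1 l2) ^ 2 * Real.sin φ ^ 2)

/-- `b = (λ₂/λ₁)²·((1 − λ₂⁻⁴)/(1 + λ₁⁻²λ₂⁻²))·(sin φ cos φ)/(λ₂²cos²φ + β sin²φ)`. -/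
noncomputable def bQ (φ l1 l2 : ℝ) : ℝ :=
  (l2 / l1) ^ 2 * ((1 - (l2 ^ 4)⁻¹) / (1 + (l1 ^ 2)⁻¹ * (l2 ^ 2)⁻¹)) *
    (Real.sin φ * Real.cos φ) / (l2 ^ 2 * Real.cos φ ^ 2 + betaQ l1 l2 * Real.sin φ ^ 2)

/-- `c = b² + a⁻²`. -/
noncomputable def cQ (φ l1 l2 : ℝ) : ℝ := (bQ φ l1 l2) ^ 2 + ((aQ φ l1 l2) ^ 2)⁻¹

/-- `μ = (a/2)·(1 + c + ((1 + c)² − 4a⁻²)^{1/2})`. -/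
noncomputable def muQ (φ l1 l2 : ℝ) : ℝ :=
  (aQ φ l1 l2 / 2) *
    (1 + cQ φ l1 l2 + Real.sqrt ((1 + cQ φ l1 l2) ^ 2 - 4 * ((aQ φ l1 l2) ^ 2)⁻¹))

theorem Zm_mul_Rot_mul_Zm (φ l1 l2 : ℝ) :
    Zm l2 * Rot φ * Zm l1 =
      !![l2 * cos φ * l1, l2 * sin φ * l1⁻¹; -(l2⁻¹ * sin φ * l1), l2⁻¹ * cos φ * l1⁻¹] := by
  ext i j
  fin_cases i <;> fin_cases j <;> simp [Zm, Rot, Matrix.mul_apply, Fin.sum_univ_two]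

theorem norm_sq_toEuclideanCLM_fin_two (p q r s : ℝ) (v : EuclideanSpace ℝ (Fin 2)) :
    ‖Matrix.toEuclideanCLM (𝕜 := ℝ) !![p, q; r, s] v‖ ^ 2 =
      (p * v 0 + q * v 1) ^ 2 + (r * v 0 + s * v 1) ^ 2 := by
  rw [EuclideanSpace.norm_sq_eq]
  simp [Fin.sum_univ_two, Matrix.ofLp_toEuclideanCLM, Matrix.mulVec, dotProduct]

/-- A matrix in `SL(2, ℝ)` with squared Frobenius norm `m² + m⁻²`, `m ≥ 1`, has operator
norm `m`. -/
theorem opNorm_eq_of_det_eq_one {p q r s m : ℝ} (hm : 1 ≤ m) (hdet : p * s - q * r = 1)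
    (hF : p ^ 2 + q ^ 2 + r ^ 2 + s ^ 2 = m ^ 2 + (m ^ 2)⁻¹) :
    opNorm !![p, q; r, s] = m := by
  have hm0 : 0 < m := by linarith
  have hm2 : (m ^ 2)⁻¹ ≤ m ^ 2 := by
    have h : 1 ≤ m ^ 2 := one_le_pow₀ hm
    exact (inv_le_one_of_one_le₀ h).trans h
  have hmm : m ^ 2 * (m ^ 2)⁻¹ = 1 := mul_inv_cancel₀ (by positivity)
  obtain ⟨x, hx⟩ : ∃ x, x = m ^ 2 - (p ^ 2 + r ^ 2) := ⟨_, rfl⟩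
  obtain ⟨y, hy⟩ : ∃ y, y = -(p * q + r * s) := ⟨_, rfl⟩
  obtain ⟨z, hz⟩ : ∃ z, z = m ^ 2 - (q ^ 2 + s ^ 2) := ⟨_, rfl⟩
  have hxz : x * z = y ^ 2 := by
    have : x * z - y ^ 2 =
        m ^ 4 - (p ^ 2 + q ^ 2 + r ^ 2 + s ^ 2) * m ^ 2 + (p * s - q * r) ^ 2 := by
      subst hx hy hz; ring
    rw [hdet, hF] at this
    nlinarith
  have htr : 0 ≤ x + z := by subst hx hz; linarith
  have hx0 : 0 ≤ x := by
    by_contra! h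
    nlinarith [sq_nonneg y, mul_pos_of_neg_of_neg h h]
  have hz0 : 0 ≤ z := by
    by_contra! h
    nlinarith [sq_nonneg y, mul_pos_of_neg_of_neg h h]
  have key (v : EuclideanSpace ℝ (Fin 2)) :
      m ^ 2 * ‖v‖ ^ 2 - ‖Matrix.toEuclideanCLM (𝕜 := ℝ) !![p, q; r, s] v‖ ^ 2 =
        x * v 0 ^ 2 + 2 * y * (v 0 * v 1) + z * v 1 ^ 2 := by
    rw [norm_sq_toEuclideanCLM_fin_two, EuclideanSpace.norm_sq_eq]
    simp only [Fin.sum_univ_two, Real.norm_eq_abs, sq_abs]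
    subst hx hy hz
    ring
  unfold opNorm
  apply le_antisymm
  · refine ContinuousLinearMap.opNorm_le_bound _ hm0.le fun v => ?_
    refine le_of_sq_le_sq ?_ (by positivity)
    have hnn : 0 ≤ x * v 0 ^ 2 + 2 * y * (v 0 * v 1) + z * v 1 ^ 2 := by
      rcases hx0.eq_or_lt with h | h
      · have : y = 0 := by
          rw [← h, zero_mul] at hxz
          exact pow_eq_zero_iff two_ne_zero |>.1 hxz.symm
        rw [← h, this]
        nlinarith [mul_nonneg hz0 (sq_nonneg (v 1))]
      · refine (mul_nonneg_iff_of_pos_left h).1 ?_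
        have : x * (x * v 0 ^ 2 + 2 * y * (v 0 * v 1) + z * v 1 ^ 2) =
            (x * v 0 + y * v 1) ^ 2 := by
          linear_combination v 1 ^ 2 * hxz
        rw [this]
        positivity
    rw [mul_pow]
    linarith [key v]
  · obtain ⟨v, hv, hq⟩ : ∃ v : EuclideanSpace ℝ (Fin 2), v ≠ 0 ∧
        x * v 0 ^ 2 + 2 * y * (v 0 * v 1) + z * v 1 ^ 2 = 0 := by
      by_cases h : x = 0
      · refine ⟨!₂[1, 0], fun h0 => ?_, by simp [h]⟩
        simpa using congrArg (fun w : EuclideanSpace ℝ (Fin 2) => w 0) h0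
      · refine ⟨!₂[y, -x], fun h0 => h ?_, ?_⟩
        · simpa using congrArg (fun w : EuclideanSpace ℝ (Fin 2) => w 1) h0
        · simp
          linear_combination x * hxz
    have hvpos : 0 < ‖v‖ := norm_pos_iff.2 hv
    have heq : ‖Matrix.toEuclideanCLM (𝕜 := ℝ) !![p, q; r, s] v‖ = m * ‖v‖ := by
      refine (sq_eq_sq₀ (norm_nonneg _) (by positivity)).1 ?_
      rw [mul_pow]
      linarith [key v]
    refine le_of_mul_le_mul_right ?_ hvpos
    rw [← heq]
    exact ContinuousLinearMap.le_opNorm _ _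

theorem betaQ_pos {l1 l2 : ℝ} (h1 : 0 < l1) (h2 : 0 < l2) : 0 < betaQ l1 l2 := by
  unfold betaQ
  positivity

theorem cos_sq_add_mul_sin_sq_pos (φ : ℝ) {k l : ℝ} (hk : 0 < k) (hl : 0 < l) :
    0 < k * cos φ ^ 2 + l * sin φ ^ 2 := by
  rcases eq_or_ne (cos φ) 0 with h | h
  · have : sin φ ^ 2 = 1 := by
      have := sin_sq_add_cos_sq φ
      rw [h] at this
      linarith
    rw [h, this]
    linarith
  · positivity

theorem aQ_pos (φ : ℝ) {l1 l2 : ℝ} (h1 : 0 < l1) (h2 : 0 < l2) : 0 < aQ φ l1 l2 := by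
  have hβ := betaQ_pos h1 h2
  have hX := cos_sq_add_mul_sin_sq_pos φ (pow_pos h2 2) hβ
  have hD := cos_sq_add_mul_sin_sq_pos φ one_pos (pow_pos hβ 2)
  rw [one_mul] at hD
  have := Real.sqrt_pos.2 hD
  unfold aQ
  positivity

/-- With `P = Z(λ₂) R(φ) Z(λ₁)`, the number `a(1 + c)` is the trace of `(PᵀP)^{1/2}`. -/
theorem aQ_mul_one_add_cQ_sq (φ : ℝ) {l1 l2 : ℝ} (h1 : 0 < l1) (h2 : 0 < l2) :
    (aQ φ l1 l2 * (1 + cQ φ l1 l2)) ^ 2 =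
      (l2 * cos φ * l1) ^ 2 + (l2 * sin φ * l1⁻¹) ^ 2 + (-(l2⁻¹ * sin φ * l1)) ^ 2 +
        (l2⁻¹ * cos φ * l1⁻¹) ^ 2 + 2 := by
  have hβ := betaQ_pos h1 h2
  have hX := cos_sq_add_mul_sin_sq_pos φ (pow_pos h2 2) hβ
  have hD := cos_sq_add_mul_sin_sq_pos φ one_pos (pow_pos hβ 2)
  rw [one_mul] at hD
  have ha0 := aQ_pos φ h1 h2
  obtain ⟨w, hw⟩ : ∃ w, w = √(cos φ ^ 2 + betaQ l1 l2 ^ 2 * sin φ ^ 2) := ⟨_, rfl⟩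
  have hw0 : 0 < w := hw ▸ Real.sqrt_pos.2 hD
  have hw2 : w ^ 2 = cos φ ^ 2 + betaQ l1 l2 ^ 2 * sin φ ^ 2 := hw ▸ Real.sq_sqrt hD.le
  have hcs := sin_sq_add_cos_sq φ
  obtain ⟨T, hT⟩ : ∃ T, T = (l1 * l2 + l1⁻¹ * l2⁻¹) * w := ⟨_, rfl⟩
  have hT0 : 0 < T := by subst hT; positivity
  have hβ' : betaQ l1 l2 = (l1 ^ 2 + l2 ^ 2) / (1 + l1 ^ 2 * l2 ^ 2) := by
    unfold betaQ; field_simp; ring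
  have hT2 : T ^ 2 = (l1 * l2 + l1⁻¹ * l2⁻¹) ^ 2 * cos φ ^ 2
      + (l1 * l2⁻¹ + l2 * l1⁻¹) ^ 2 * sin φ ^ 2 := by
    rw [hT, mul_pow, hw2, hβ']; field_simp; ring
  obtain ⟨u, hu⟩ : ∃ u, u = l1 ^ 2 * l2 ^ 2 * cos φ ^ 2 + l1 ^ 2 * (l2 ^ 2)⁻¹ * sin φ ^ 2 + 1 :=
    ⟨_, rfl⟩
  have hXu : (l1 ^ 2 + (l2 ^ 2)⁻¹) * (l2 ^ 2 * cos φ ^ 2 + betaQ l1 l2 * sin φ ^ 2) = u := by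
    rw [hu, ← hcs, hβ']; field_simp; ring
  have ha : aQ φ l1 l2 * T = u := by
    rw [← hXu, hT]; unfold aQ; rw [← hw]; field_simp
  have hab : bQ φ l1 l2 * u = (l2 ^ 2 - (l2 ^ 2)⁻¹) * (sin φ * cos φ) := by
    rw [← hXu]
    unfold bQ
    generalize l2 ^ 2 * cos φ ^ 2 + betaQ l1 l2 * sin φ ^ 2 = X at hX
    field_simp
  have hTu : T ^ 2 + (bQ φ l1 l2 * u) ^ 2 = u * (T ^ 2 - u) := by
    rw [hab, hT2, hu, mul_pow, mul_pow (sin φ), Real.sin_sq]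
    field_simp
    ring
  have hmain : aQ φ l1 l2 * (1 + cQ φ l1 l2) = T := by
    have haT : aQ φ l1 l2 = u / T := by rw [← ha]; field_simp
    have hu0 : 0 < u := by rw [← ha]; positivity
    unfold cQ
    rw [haT]
    field_simp
    linear_combination hTu
  rw [hmain, hT2]
  field_simp
  linear_combination (2 * l1 ^ 2 * l2 ^ 2) * hcs

/-- for `φ ∈ [0, π)` and `λ₁, λ₂ > 1`, the operator norm of
`P₁ = Z(λ₂) R(φ) Z(λ₁)` equals `μ`, and `μ = 1 ↔ (a = 1 ∧ b = 0)`. -/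
theorem stmt1 (φ l1 l2 : ℝ) (hφ : φ ∈ Set.Ico (0 : ℝ) Real.pi)
    (h1 : 1 < l1) (h2 : 1 < l2) :
    opNorm (Zm l2 * Rot φ * Zm l1) = muQ φ l1 l2 ∧
      (muQ φ l1 l2 = 1 ↔ aQ φ l1 l2 = 1 ∧ bQ φ l1 l2 = 0) := by
  have h1' : 0 < l1 := by linarith
  have h2' : 0 < l2 := by linarith
  have hT := aQ_mul_one_add_cQ_sq φ h1' h2'
  have ha := aQ_pos φ h1' h2'
  rw [Zm_mul_Rot_mul_Zm]
  have hc : aQ φ l1 l2 * (1 + cQ φ l1 l2) =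
      aQ φ l1 l2 + aQ φ l1 l2 * bQ φ l1 l2 ^ 2 + (aQ φ l1 l2)⁻¹ := by
    unfold cQ
    field_simp
    ring
  unfold muQ
  generalize aQ φ l1 l2 = a at *
  generalize bQ φ l1 l2 = b at *
  generalize cQ φ l1 l2 = c at *
  have hinv : a + a⁻¹ - 2 = (a - 1) ^ 2 * a⁻¹ := by field_simp; ring
  have hsq : 0 ≤ (a - 1) ^ 2 * a⁻¹ := by positivity
  have hab : 0 ≤ a * b ^ 2 := by positivity
  have hT2 : 2 ≤ a * (1 + c) := by linarith
  have hdisc : (a * (1 + c)) ^ 2 - 4 = a ^ 2 * ((1 + c) ^ 2 - 4 * (a ^ 2)⁻¹) := by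
    field_simp
  have hmu : a / 2 * (1 + c + √((1 + c) ^ 2 - 4 * (a ^ 2)⁻¹)) =
      (a * (1 + c) + √((a * (1 + c)) ^ 2 - 4)) / 2 := by
    rw [hdisc, Real.sqrt_mul (by positivity), Real.sqrt_sq ha.le]
    ring
  rw [hmu]
  generalize a * (1 + c) = T at *
  have hS := Real.sq_sqrt (show 0 ≤ T ^ 2 - 4 by nlinarith)
  have hS0 := Real.sqrt_nonneg (T ^ 2 - 4)
  constructor
  · generalize √(T ^ 2 - 4) = S at *
    obtain ⟨m, hm⟩ : ∃ m, m = (T + S) / 2 := ⟨_, rfl⟩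
    rw [← hm]
    have hm1 : 1 ≤ m := by linarith
    have hq : m ^ 2 - T * m + 1 = 0 := by
      rw [hm]
      linear_combination hS / 4
    have hTm : T = m + m⁻¹ := by field_simp; linarith
    refine opNorm_eq_of_det_eq_one hm1 ?_ ?_
    · field_simp
      linear_combination sin_sq_add_cos_sq φ
    · have : T ^ 2 = m ^ 2 + (m ^ 2)⁻¹ + 2 := by
        rw [hTm]; field_simp; ring
      linarith
  · constructor
    · intro h
      have hT' : T = 2 := by linarith
      have e1 : (a - 1) ^ 2 * a⁻¹ = 0 := by linarith
      have e2 : a * b ^ 2 = 0 := by linarith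
      constructor
      · have := (mul_eq_zero.1 e1).resolve_right (by positivity)
        linarith [pow_eq_zero_iff two_ne_zero |>.1 this]
      · exact pow_eq_zero_iff two_ne_zero |>.1 ((mul_eq_zero.1 e2).resolve_left ha.ne')
    · rintro ⟨rfl, rfl⟩
      have hT' : T = 2 := by rw [hc]; norm_num
      rw [hT']
      norm_num
end

section
/- There exists λ* > 1 such that for every λ₀ ≥ λ*, every constant C₃ > 0 and every point x ∈ 𝕋¹ whose iterates satisfy |cos(φ(σ_ω^k(x)))| ≥ C₃ for all k = 0, …, n−1, there exists a positive constant C_M < C₃ (depending only on C₃) such that the cocycle satisfies ‖M(x, n)‖ ≥ (C_M λ₀)^n. -/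
open Real Matrix

/-- The fibre map `A(x) = R(φ(x))·Z(λ(x))` (the circle `𝕋¹ = ℝ/ℤ` is modelled by
`1`-periodic functions on `ℝ`). -/
noncomputable def Amat (φf lf : ℝ → ℝ) (x : ℝ) : Matrix (Fin 2) (Fin 2) ℝ :=
  Rot (φf x) * Zm (lf x)

/-- The cocycle `M(x, n) = A(σ_ω^{n−1}(x))·…·A(x)` over the rotation `σ_ω(x) = x + ω`. -/
noncomputable def Coc (ω : ℝ) (φf lf : ℝ → ℝ) (x : ℝ) : ℕ → Matrix (Fin 2) (Fin 2) ℝ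
  | 0 => 1
  | n + 1 => Amat φf lf (x + n * ω) * Coc ω φf lf x n

/-- Each column of a matrix is bounded by the operator norm. -/
lemma col_sq_le_opNorm_sq (A : Matrix (Fin 2) (Fin 2) ℝ) (j : Fin 2) :
    A 0 j ^ 2 + A 1 j ^ 2 ≤ opNorm A ^ 2 := by
  have h := (Matrix.toEuclideanCLM (𝕜 := ℝ) A).le_opNorm (EuclideanSpace.single j 1)
  rw [PiLp.norm_single, norm_one, mul_one] at h
  have h2 := pow_le_pow_left₀ (norm_nonneg _) h 2
  rw [EuclideanSpace.norm_sq_eq] at h2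
  simpa [Fin.sum_univ_two, opNorm, Matrix.ofLp_toEuclideanCLM, sq_abs] using h2

lemma opNorm_nonneg (A : Matrix (Fin 2) (Fin 2) ℝ) : 0 ≤ opNorm A := norm_nonneg _

lemma abs_apply_le_opNorm (A : Matrix (Fin 2) (Fin 2) ℝ) : |A 0 0| ≤ opNorm A :=
  abs_le_of_sq_le_sq (by nlinarith [col_sq_le_opNorm_sq A 0, sq_nonneg (A 1 0)])
    (opNorm_nonneg A)

lemma one_le_opNorm_of_det_eq_one {A : Matrix (Fin 2) (Fin 2) ℝ} (hA : A.det = 1) :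
    1 ≤ opNorm A := by
  rw [Matrix.det_fin_two] at hA
  have h0 := col_sq_le_opNorm_sq A 0
  have h1 := col_sq_le_opNorm_sq A 1
  have hsq : 1 ≤ opNorm A ^ 2 := by
    nlinarith [sq_nonneg (A 0 0 - A 1 1), sq_nonneg (A 0 1 + A 1 0)]
  exact (one_le_sq_iff₀ (opNorm_nonneg A)).mp hsq

lemma det_Amat {φf lf : ℝ → ℝ} {y : ℝ} (hl : lf y ≠ 0) : (Amat φf lf y).det = 1 := by
  rw [Amat, Matrix.det_mul, Rot, Zm, Matrix.det_fin_two_of, Matrix.det_fin_two_of]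
  rw [mul_zero, sub_zero, mul_inv_cancel₀ hl]
  nlinarith [Real.sin_sq_add_cos_sq (φf y)]

lemma det_Coc (ω : ℝ) {φf lf : ℝ → ℝ} (x : ℝ) (hl : ∀ y, lf y ≠ 0) (n : ℕ) :
    (Coc ω φf lf x n).det = 1 := by
  induction n with
  | zero => simp [Coc]
  | succ n ih => rw [Coc, Matrix.det_mul, ih, det_Amat (hl _), mul_one]

/-- The cone `|b| ≤ (2 / C) |a|` is mapped into itself by `R(φ)·Z(l)` when `|cos φ| ≥ C` and `l`
is large, and the first coordinate grows at least by the factor `C l / 2`. -/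
lemma cone_step {C l φ a b : ℝ} (hC : 0 < C) (hl : 1 + 2 / C ≤ l) (hφ : C ≤ |Real.cos φ|)
    (hab : |b| ≤ 2 / C * |a|) :
    |-Real.sin φ * l * a + Real.cos φ * l⁻¹ * b| ≤
        2 / C * |Real.cos φ * l * a + Real.sin φ * l⁻¹ * b| ∧
      C / 2 * l * |a| ≤ |Real.cos φ * l * a + Real.sin φ * l⁻¹ * b| := by
  set K := 2 / C with hK
  have hKpos : 0 < K := by positivity
  have hKC : K * C = 2 := div_mul_cancel₀ 2 hC.ne'
  have hlpos : 0 < l := by linarith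
  have hs := Real.abs_sin_le_one φ
  have hc := Real.abs_cos_le_one φ
  have ha := abs_nonneg a
  have hb : l⁻¹ * |b| * (1 + K) ≤ K * |a| := by
    have h1 : l⁻¹ * (1 + K) ≤ 1 := by
      rw [inv_mul_le_iff₀ hlpos]; linarith
    nlinarith [mul_le_mul_of_nonneg_right h1 (abs_nonneg b)]
  have hbnn : 0 ≤ l⁻¹ * |b| := by positivity
  have hla : (1 + K) * |a| ≤ l * |a| := mul_le_mul_of_nonneg_right hl ha
  have hlow : C * (l * |a|) - l⁻¹ * |b| ≤ |Real.cos φ * l * a + Real.sin φ * l⁻¹ * b| := by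
    have h1 : |Real.cos φ * l * a| = |Real.cos φ| * (l * |a|) := by
      rw [abs_mul, abs_mul, abs_of_pos hlpos, mul_assoc]
    have h2 : |Real.sin φ * l⁻¹ * b| = |Real.sin φ| * (l⁻¹ * |b|) := by
      rw [abs_mul, abs_mul, abs_of_pos (inv_pos.mpr hlpos), mul_assoc]
    have h3 := abs_sub_abs_le_abs_add (Real.cos φ * l * a) (Real.sin φ * l⁻¹ * b)
    have h4 : C * (l * |a|) ≤ |Real.cos φ| * (l * |a|) :=
      mul_le_mul_of_nonneg_right hφ (by positivity)
    have h5 := mul_le_mul_of_nonneg_right hs hbnn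
    linarith
  have hup : |-Real.sin φ * l * a + Real.cos φ * l⁻¹ * b| ≤ l * |a| + l⁻¹ * |b| := by
    have h1 : |-Real.sin φ * l * a| = |Real.sin φ| * (l * |a|) := by
      rw [abs_mul, abs_mul, abs_neg, abs_of_pos hlpos, mul_assoc]
    have h2 : |Real.cos φ * l⁻¹ * b| = |Real.cos φ| * (l⁻¹ * |b|) := by
      rw [abs_mul, abs_mul, abs_of_pos (inv_pos.mpr hlpos), mul_assoc]
    have h3 := abs_add_le (-Real.sin φ * l * a) (Real.cos φ * l⁻¹ * b)
    have h4 := mul_le_mul_of_nonneg_right hs (show 0 ≤ l * |a| by positivity)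
    have h5 := mul_le_mul_of_nonneg_right hc hbnn
    linarith
  have hKlow := mul_le_mul_of_nonneg_left hlow hKpos.le
  have hKCla : K * (C * (l * |a|)) = 2 * (l * |a|) := by rw [← mul_assoc, hKC]
  refine ⟨by linarith, le_of_mul_le_mul_left ?_ hKpos⟩
  have hgoal : K * (C / 2 * l * |a|) = l * |a| := by linear_combination (l * |a| / 2) * hKC
  linarith

lemma Coc_growth {C ω lam0 x : ℝ} {φf lf : ℝ → ℝ} (hC : 0 < C) (hlam : 1 + 2 / C ≤ lam0)
    (hl : ∀ y, lam0 ≤ lf y) (n : ℕ) (hφ : ∀ k : ℕ, k < n → C ≤ |Real.cos (φf (x + k * ω))|) :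
    |Coc ω φf lf x n 1 0| ≤ 2 / C * |Coc ω φf lf x n 0 0| ∧
      (C / 2 * lam0) ^ n ≤ |Coc ω φf lf x n 0 0| := by
  induction n with
  | zero => simp [Coc]; positivity
  | succ n ih =>
    obtain ⟨hcone, hgrow⟩ := ih fun k hk => hφ k (hk.trans n.lt_succ_self)
    obtain ⟨hcone', hgrow'⟩ :=
      cone_step hC (hlam.trans (hl (x + n * ω))) (hφ n n.lt_succ_self) hcone
    have h00 : Coc ω φf lf x (n + 1) 0 0 =
        Real.cos (φf (x + n * ω)) * lf (x + n * ω) * Coc ω φf lf x n 0 0 +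
          Real.sin (φf (x + n * ω)) * (lf (x + n * ω))⁻¹ * Coc ω φf lf x n 1 0 := by
      simp [Coc, Amat, Rot, Zm, Matrix.mul_apply, Fin.sum_univ_two]
    have h10 : Coc ω φf lf x (n + 1) 1 0 =
        -Real.sin (φf (x + n * ω)) * lf (x + n * ω) * Coc ω φf lf x n 0 0 +
          Real.cos (φf (x + n * ω)) * (lf (x + n * ω))⁻¹ * Coc ω φf lf x n 1 0 := by
      simp [Coc, Amat, Rot, Zm, Matrix.mul_apply, Fin.sum_univ_two]
    rw [h00, h10]
    refine ⟨hcone', le_trans ?_ hgrow'⟩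
    have hlam0 : 0 < lam0 := lt_of_lt_of_le (by positivity) hlam
    rw [pow_succ']
    exact mul_le_mul (mul_le_mul_of_nonneg_left (hl _) (by positivity)) hgrow (by positivity)
      (mul_nonneg (by positivity) (hlam0.le.trans (hl _)))

/-- non-collision growth lemma: there is `λ* > 1` such that for every
`lam0 ≥ λ*` and every `C₃ > 0` there is a constant `0 < C_M < C₃` (depending only on `C₃`)
such that whenever the trajectory of `x` satisfies `|cos φ(σ_ω^k x)| ≥ C₃` for
`k = 0, …, n−1`, one has `‖M(x, n)‖ ≥ (C_M lam0)^n`. -/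
theorem stmt3 :
    ∃ lamStar : ℝ, 1 < lamStar ∧
      ∀ C₃ : ℝ, 0 < C₃ →
        ∃ C_M : ℝ, 0 < C_M ∧ C_M < C₃ ∧
          ∀ (ω : ℝ) (φf lf : ℝ → ℝ) (lam0 x : ℝ) (n : ℕ),
            Irrational ω →
            Function.Periodic φf 1 → Function.Periodic lf 1 →
            lamStar ≤ lam0 →
            (∀ y : ℝ, lam0 ≤ lf y) →
            (∀ k : ℕ, k < n → C₃ ≤ |Real.cos (φf (x + k * ω))|) →
            (C_M * lam0) ^ n ≤ opNorm (Coc ω φf lf x n) := by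
  refine ⟨2, one_lt_two, fun C hC => ?_⟩
  have hKpos : 0 < 1 + 2 / C := by positivity
  refine ⟨min (C / 2) (1 + 2 / C)⁻¹, lt_min (by positivity) (by positivity),
    (min_le_left _ _).trans_lt (half_lt_self hC), ?_⟩
  intro ω φf lf lam0 x n _ _ _ hlam0 hl hφ
  have hlam0pos : 0 < lam0 := two_pos.trans_le hlam0
  have hmin : 0 < min (C / 2) (1 + 2 / C)⁻¹ := lt_min (by positivity) (by positivity)
  rcases le_total (1 + 2 / C) lam0 with h | h
  · refine le_trans ?_ ((Coc_growth hC h hl n hφ).2.trans (abs_apply_le_opNorm _))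
    exact pow_le_pow_left₀ (by positivity)
      (mul_le_mul_of_nonneg_right (min_le_left _ _) hlam0pos.le) n
  · refine le_trans (pow_le_one₀ (by positivity) ?_)
      (one_le_opNorm_of_det_eq_one (det_Coc ω x (fun y => (hlam0pos.trans_le (hl y)).ne') n))
    calc min (C / 2) (1 + 2 / C)⁻¹ * lam0 ≤ (1 + 2 / C)⁻¹ * (1 + 2 / C) :=
          mul_le_mul (min_le_right _ _) h hlam0pos.le (by positivity)
      _ = 1 := inv_mul_cancel₀ hKpos.ne'
end

section
/- For every constant C with 0 < C < 1 there exists K > 1 and a constant C' > 0 such that: whenever λ₁ ≥ K and λ₂ ≥ K·λ₁, then for every angle φ₁ the operator norm μ of the product P₁ = Z(λ₂) R(φ₁) Z(λ₁) satisfies μ ≥ C·(λ₂/λ₁)·(1 − C'·(λ₁/λ₂)²). -/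
open Real Matrix

/-- The norm of the first row of a matrix bounds its Euclidean operator norm from below. -/
theorem sqrt_sq_add_sq_row_le_opNorm (A : Matrix (Fin 2) (Fin 2) ℝ) :
    √(A 0 0 ^ 2 + A 0 1 ^ 2) ≤ opNorm A := by
  set v : EuclideanSpace ℝ (Fin 2) := !₂[A 0 0, A 0 1] with hv
  have hnorm : ‖v‖ = √(A 0 0 ^ 2 + A 0 1 ^ 2) := by
    simp [hv, EuclideanSpace.norm_eq, Fin.sum_univ_two]
  have happly : (Matrix.toEuclideanCLM (𝕜 := ℝ) A v) 0 = ‖v‖ ^ 2 := by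
    rw [hnorm, Real.sq_sqrt (by positivity)]
    simp [hv]
    ring
  have hcoord := PiLp.norm_apply_le (Matrix.toEuclideanCLM (𝕜 := ℝ) A v) 0
  have hop := (Matrix.toEuclideanCLM (𝕜 := ℝ) A).le_opNorm v
  rw [happly, Real.norm_of_nonneg (by positivity)] at hcoord
  rw [← hnorm, opNorm]
  rcases (norm_nonneg v).eq_or_lt with h | h
  · rw [← h]
    exact norm_nonneg _
  · exact le_of_mul_le_mul_right (by linarith [sq ‖v‖]) h

theorem div_le_opNorm_Zm_mul_Rot_mul_Zm {l1 l2 : ℝ} (φ : ℝ) (h1 : 1 ≤ l1) :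
    l2 / l1 ≤ opNorm (Zm l2 * Rot φ * Zm l1) := by
  refine le_trans (Real.le_sqrt_of_sq_le ?_) (sqrt_sq_add_sq_row_le_opNorm _)
  have hinv : l1⁻¹ ^ 2 ≤ l1 ^ 2 :=
    pow_le_pow_left₀ (by positivity) ((inv_le_one_of_one_le₀ h1).trans h1) 2
  have hmul := mul_le_mul_of_nonneg_left hinv (mul_nonneg (sq_nonneg l2) (sq_nonneg (cos φ)))
  simp only [Zm, Rot, Matrix.mul_apply, Fin.sum_univ_two, Matrix.of_apply, Matrix.cons_val_zero,
    Matrix.cons_val_one, Matrix.cons_val', Matrix.cons_val_fin_one]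
  rw [div_eq_mul_inv]
  linear_combination hmul + l2 ^ 2 * l1⁻¹ ^ 2 * (sin_sq_add_cos_sq φ).symm

/-- for every `0 < C < 1` there are `K > 1` and `C' > 0` such that
for `λ₁ ≥ K`, `λ₂ ≥ K·λ₁` and every angle `φ₁`, the operator norm of
`P₁ = Z(λ₂) R(φ₁) Z(λ₁)` is at least `C·(λ₂/λ₁)·(1 − C'·(λ₁/λ₂)²)`. -/
theorem stmt5 (C : ℝ) (hC0 : 0 < C) (hC : C < 1) :
    ∃ K C' : ℝ, 1 < K ∧ 0 < C' ∧
      ∀ l1 l2 φ1 : ℝ, K ≤ l1 → K * l1 ≤ l2 →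
        C * (l2 / l1) * (1 - C' * (l1 / l2) ^ 2) ≤
          opNorm (Zm l2 * Rot φ1 * Zm l1) := by
  refine ⟨2, 1, one_lt_two, one_pos, fun l1 l2 φ1 h1 h2 => ?_⟩
  have hpos : 0 ≤ l2 / l1 := div_nonneg (by linarith) (by linarith)
  calc C * (l2 / l1) * (1 - 1 * (l1 / l2) ^ 2) ≤ C * (l2 / l1) * 1 :=
        mul_le_mul_of_nonneg_left (by linarith [sq_nonneg (l1 / l2)]) (by positivity)
    _ ≤ l2 / l1 := by
        rw [mul_one]
        exact mul_le_of_le_one_left hpos hC.le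
    _ ≤ _ := div_le_opNorm_Zm_mul_Rot_mul_Zm φ1 (by linarith)
end

section
/- Let h ∈ ℋ. If the series Σ_{n=1}^∞ 1/h(2^{(n−1)/2}) converges, then the set of ω ∈ (0, 1) that satisfy condition (A) with the function h has Lebesgue measure zero; nevertheless, for every h ∈ ℋ this set is dense in (0, 1). -/
open Real MeasureTheory

/-- `q ≥ 1` is a best-approximation denominator of `ω`: `‖qω‖ < ‖q'ω‖` for all
`1 ≤ q' < q`, where `‖·‖` is the distance to the nearest integer. -/
def IsBestDen (ω : ℝ) (q : ℕ) : Prop :=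
  1 ≤ q ∧ ∀ q' : ℕ, 1 ≤ q' → q' < q →
    |(q : ℝ) * ω - round ((q : ℝ) * ω)| < |(q' : ℝ) * ω - round ((q' : ℝ) * ω)|

/-- `q : ℕ → ℕ` enumerates (in increasing order) the denominators of the best rational
approximations of `ω`. -/
def BestDenSeq (ω : ℝ) (q : ℕ → ℕ) : Prop :=
  StrictMono q ∧ (∀ n, IsBestDen ω (q n)) ∧ ∀ m : ℕ, IsBestDen ω m → ∃ n, q n = m

/-- The class `ℋ` of strictly increasing functions `h : (0,∞) → (0,∞)` with
`h(x)/x → 0` as `x → ∞`. -/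
def MemH (h : ℝ → ℝ) : Prop :=
  (∀ x : ℝ, 0 < x → 0 < h x) ∧ StrictMonoOn h (Set.Ioi (0 : ℝ)) ∧
    Filter.Tendsto (fun x => h x / x) Filter.atTop (nhds 0)

/-- `ω` satisfies condition (A) with `h` and the constant `C_t`. -/
def CondAWith (ω : ℝ) (h : ℝ → ℝ) (Ct : ℝ) : Prop :=
  ∃ q : ℕ → ℕ, BestDenSeq ω q ∧
    ∃ (nj : ℕ → ℕ) (Cδ : ℝ), StrictMono nj ∧ 0 < Cδ ∧ Cδ < 1 ∧
      (∀ j : ℕ, (q (nj j) : ℝ) * h (q (nj j)) < (q (nj j + 1) : ℝ)) ∧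
      ∃ J : ℕ → ℕ, ∀ k : ℕ,
        (1 / (q (nj (J k)) : ℝ)) *
            (Real.log ((q (nj (J k)) : ℝ) * h (q (nj (J k)))) + Real.log Cδ⁻¹) <
          Real.log ((q (nj (J (k + 1))) : ℝ) * h (q (nj (J (k + 1))))) /
            (q (nj (J k)) : ℝ) ∧
        Real.log ((q (nj (J (k + 1))) : ℝ) * h (q (nj (J (k + 1))))) /
            (q (nj (J k)) : ℝ) < Ct

/-- `ω` satisfies condition (A) with `h` (for some positive constant `C_t`). -/
def CondA (ω : ℝ) (h : ℝ → ℝ) : Prop := ∃ Ct : ℝ, 0 < Ct ∧ CondAWith ω h Ct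

/-- A best denominator minimizes the distance to the nearest integer among all positive integers
below the next best denominator. -/
lemma BestDenSeq.abs_le_of_lt {ω : ℝ} {q : ℕ → ℕ} (hq : BestDenSeq ω q) (n k : ℕ)
    (hk : 1 ≤ k) (hkn : k < q (n + 1)) :
    |(q n : ℝ) * ω - round ((q n : ℝ) * ω)| ≤ |(k : ℝ) * ω - round ((k : ℝ) * ω)| := by
  induction k using Nat.strong_induction_on with
  | _ k ih =>
    by_cases hb : IsBestDen ω k
    · obtain ⟨m, rfl⟩ := hq.2.2 k hb
      have hm : m ≤ n := Nat.lt_succ_iff.1 (hq.1.lt_iff_lt.1 hkn)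
      rcases hm.eq_or_lt with rfl | hm
      · exact le_rfl
      · exact ((hq.2.1 n).2 _ hk (hq.1 hm)).le
    · simp only [IsBestDen, not_and, not_forall, not_lt] at hb
      obtain ⟨k', h1, h2, h3⟩ := hb hk
      exact (ih k' h2 h1 (h2.trans hkn)).trans h3

lemma BestDenSeq.abs_le_inv {ω : ℝ} {q : ℕ → ℕ} (hq : BestDenSeq ω q) (n : ℕ) :
    |(q n : ℝ) * ω - round ((q n : ℝ) * ω)| ≤ 1 / q (n + 1) := by
  have h1 : 1 ≤ q n := (hq.2.1 n).1
  have h2 : q n < q (n + 1) := hq.1 n.lt_succ_self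
  obtain ⟨k, hk0, hk, hle⟩ := Real.exists_nat_abs_mul_sub_round_le ω
    (n := q (n + 1) - 1) (by omega)
  refine (hq.abs_le_of_lt n k hk0 (by omega)).trans (hle.trans_eq ?_)
  congr 1
  rw [Nat.cast_sub (by omega)]
  simp

lemma CondA.frequently {ω : ℝ} {h : ℝ → ℝ} (hpos : ∀ x : ℝ, 0 < x → 0 < h x)
    (hA : CondA ω h) :
    ∃ᶠ n : ℕ in Filter.atTop, 1 ≤ n ∧ |(n : ℝ) * ω - round ((n : ℝ) * ω)| < 1 / (n * h n) := by
  obtain ⟨_, _, q, hq, nj, _, hnj, _, _, hlt, _⟩ := hA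
  rw [Filter.frequently_atTop]
  intro N
  refine ⟨q (nj N), (hnj.id_le N).trans (hq.1.id_le _), (hq.2.1 _).1, ?_⟩
  have h1 : (0 : ℝ) < q (nj N) := by exact_mod_cast (hq.2.1 (nj N)).1
  exact (hq.abs_le_inv _).trans_lt
    (one_div_lt_one_div_of_lt (mul_pos h1 (hpos _ h1)) (hlt N))

lemma summable_one_div_mul {h : ℝ → ℝ} (hpos : ∀ x : ℝ, 0 < x → 0 < h x)
    (hmono : StrictMonoOn h (Set.Ioi (0 : ℝ)))
    (hs : Summable fun n : ℕ => 1 / h ((2 : ℝ) ^ (((n : ℝ) - 1) / 2))) :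
    Summable fun n : ℕ => 1 / ((n : ℝ) * |h n|) := by
  refine (summable_condensed_iff_of_nonneg (fun n => by positivity) ?_).1 ?_
  · intro m n hm hmn
    have h1 : (0 : ℝ) < m := by exact_mod_cast hm
    have h2 : (m : ℝ) ≤ n := by exact_mod_cast hmn
    have h3 := hpos m h1
    have h4 : h m ≤ h n := hmono.monotoneOn h1 (h1.trans_le h2) h2
    rw [abs_of_pos h3, abs_of_pos (h3.trans_le h4)]
    gcongr
  · have hinj : Function.Injective fun k : ℕ => 2 * k + 1 := fun a b hab => by
      simp only at hab; omega
    refine (hs.comp_injective hinj).congr fun k => ?_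
    have h2 : ((2 : ℝ) ^ ((((2 * k + 1 : ℕ) : ℝ) - 1) / 2)) = 2 ^ k := by
      rw [← Real.rpow_natCast]
      congr 1
      push_cast
      ring
    have h3 : (0 : ℝ) < 2 ^ k := by positivity
    simp only [Function.comp, h2]
    push_cast
    rw [abs_of_pos (hpos _ h3)]
    have := (hpos _ h3).ne'
    field_simp

lemma volume_near_rational_le (n : ℕ) (hn : 1 ≤ n) (r : ℝ) (hr : 0 ≤ r) :
    volume {ω : ℝ | ω ∈ Set.Ioo (0 : ℝ) 1 ∧ |(n : ℝ) * ω - round ((n : ℝ) * ω)| < r} ≤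
      ENNReal.ofReal (4 * r) := by
  have hn0 : (1 : ℝ) ≤ n := by exact_mod_cast hn
  have hsub : {ω : ℝ | ω ∈ Set.Ioo (0 : ℝ) 1 ∧ |(n : ℝ) * ω - round ((n : ℝ) * ω)| < r} ⊆
      ⋃ p ∈ Finset.range (n + 1), Metric.ball ((p : ℝ) / n) (r / n) := by
    rintro ω ⟨⟨h0, h1⟩, hr⟩
    have hp0 : 0 ≤ round ((n : ℝ) * ω) := by
      rw [round_eq]
      exact Int.floor_nonneg.2 (by positivity)
    have hp1 : round ((n : ℝ) * ω) ≤ n := by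
      rw [round_eq, ← Int.lt_add_one_iff, Int.floor_lt]
      push_cast
      nlinarith
    obtain ⟨p, hp⟩ := Int.eq_ofNat_of_zero_le hp0
    rw [hp] at hp1 hr
    simp only [Set.mem_iUnion]
    refine ⟨p, Finset.mem_range.2 (by omega), ?_⟩
    rw [Metric.mem_ball, Real.dist_eq, lt_div_iff₀ (by positivity)]
    have : |ω - p / n| * n = |(n : ℝ) * ω - p| := by
      rw [← abs_of_pos (show (0 : ℝ) < n by positivity), ← abs_mul,
        abs_of_pos (show (0 : ℝ) < n by positivity)]
      congr 1
      field_simp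
    rw [this]
    exact_mod_cast hr
  refine (measure_mono hsub).trans ((measure_biUnion_finset_le _ _).trans ?_)
  simp only [Real.volume_ball, Finset.sum_const, Finset.card_range, nsmul_eq_mul]
  rw [← ENNReal.ofReal_natCast, ← ENNReal.ofReal_mul (by positivity)]
  refine ENNReal.ofReal_le_ofReal ?_
  push_cast
  rw [show ((n : ℝ) + 1) * (2 * (r / n)) = 2 * r * (n + 1) / n by ring, div_le_iff₀ (by positivity)]
  nlinarith

lemma volume_condA_eq_zero {h : ℝ → ℝ} (hpos : ∀ x : ℝ, 0 < x → 0 < h x)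
    (hmono : StrictMonoOn h (Set.Ioi (0 : ℝ)))
    (hs : Summable fun n : ℕ => 1 / h ((2 : ℝ) ^ (((n : ℝ) - 1) / 2))) :
    volume {ω ∈ Set.Ioo (0 : ℝ) 1 | Irrational ω ∧ CondA ω h} = 0 := by
  let s : ℕ → Set ℝ := fun n => {ω : ℝ | 1 ≤ n ∧ ω ∈ Set.Ioo (0 : ℝ) 1 ∧
    |(n : ℝ) * ω - round ((n : ℝ) * ω)| < 1 / (n * h n)}
  have hsum : ∑' n, volume (s n) ≠ ⊤ := by
    have hfin := ((summable_one_div_mul hpos hmono hs).mul_left 4).tsum_ofReal_ne_top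
    refine ne_top_of_le_ne_top hfin (ENNReal.tsum_le_tsum fun n => ?_)
    by_cases hn : 1 ≤ n
    · have hn0 : (0 : ℝ) < n := by exact_mod_cast hn
      rw [abs_of_pos (hpos n hn0)]
      refine (measure_mono ?_).trans (volume_near_rational_le n hn (1 / (n * h n))
        (by have := hpos n hn0; positivity))
      exact fun ω hω => hω.2
    · simp [s, hn]
  refine measure_mono_null ?_ (measure_setOfPred_frequently_eq_zero hsum)
  rintro ω ⟨hω, -, hA⟩
  exact (hA.frequently hpos).mono fun n hn => ⟨hn.1, hω, hn.2⟩

/-- The law of best approximation for a unimodular pair of fractions bracketing `ω`. -/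
lemma abs_le_of_unimodular {ω : ℝ} {P P' p : ℤ} {Q Q' q : ℕ} (hQ : 1 ≤ Q)
    (hdet : (P' * Q - P * Q') ^ 2 = 1)
    (hsgn : ((Q : ℝ) * ω - P) * ((Q' : ℝ) * ω - P') ≤ 0) (hq : 1 ≤ q) (hqQ : q < Q') :
    |(Q : ℝ) * ω - P| ≤ |(q : ℝ) * ω - p| := by
  obtain ⟨x, y, hxq, hxp⟩ : ∃ x y : ℤ, (q : ℤ) = x * Q + y * Q' ∧ p = x * P + y * P' :=
    ⟨(P' * Q - P * Q') * (q * P' - p * Q'), (P' * Q - P * Q') * (p * Q - q * P),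
      by linear_combination -(q : ℤ) * hdet, by linear_combination -p * hdet⟩
  have hx : x ≠ 0 := by
    rintro rfl
    rcases le_or_gt y 0 with hy | hy <;> nlinarith
  have hxy : x * y ≤ 0 := by
    by_contra! hxy
    rcases pos_and_pos_or_neg_and_neg_of_mul_pos hxy with ⟨h1, h2⟩ | ⟨h1, h2⟩ <;> nlinarith
  have hxq' : (q : ℝ) = x * Q + y * Q' := by exact_mod_cast hxq
  have hx1 : (1 : ℝ) ≤ (x : ℝ) ^ 2 := by
    exact_mod_cast Int.add_one_le_iff.2 (pow_pos (abs_pos.2 hx) 2 |>.trans_eq (sq_abs x))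
  have hxyr : (x * y : ℝ) ≤ 0 := by exact_mod_cast hxy
  have heq : (q : ℝ) * ω - p = x * (Q * ω - P) + y * (Q' * ω - P') := by
    rw [hxq', hxp]
    push_cast
    ring
  rw [heq]
  refine sq_le_sq.1 ?_
  nlinarith [mul_nonneg_of_nonpos_of_nonpos hxyr hsgn, sq_nonneg ((y : ℝ) * (Q' * ω - P')),
    mul_nonneg (sub_nonneg.2 hx1) (sq_nonneg (Q * ω - P))]

lemma IsBestDen.not_of_abs_le {ω : ℝ} {q q' : ℕ} (hq : 1 ≤ q) (hqq' : q < q')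
    (hle : |(q : ℝ) * ω - round ((q : ℝ) * ω)| ≤ |(q' : ℝ) * ω - round ((q' : ℝ) * ω)|) :
    ¬ IsBestDen ω q' :=
  fun hb => (hb.2 q hq hqq').not_ge hle

lemma irrational_of_isBestDen {ω : ℝ} (hinf : ∀ N : ℕ, ∃ q, N < q ∧ IsBestDen ω q) :
    Irrational ω := by
  rintro ⟨r, rfl⟩
  obtain ⟨q, hq, hb⟩ := hinf r.den
  refine IsBestDen.not_of_abs_le r.pos hq ?_ hb
  have : (r.den : ℝ) * (r : ℝ) = (r.num : ℤ) := by
    exact_mod_cast Rat.den_mul_eq_num r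
  rw [this, round_intCast]
  simp

/-- The continuants with partial quotients `A (Q n)` prescribed by the current denominator. -/
lemma exists_continuants (A : ℕ → ℕ) (p₀ p₁ : ℤ) (q₀ q₁ : ℕ) :
    ∃ (P : ℕ → ℤ) (Q : ℕ → ℕ), P 0 = p₀ ∧ P 1 = p₁ ∧ Q 0 = q₀ ∧ Q 1 = q₁ ∧
      (∀ n, P (n + 2) = A (Q (n + 1)) * P (n + 1) + P n) ∧
      ∀ n, Q (n + 2) = A (Q (n + 1)) * Q (n + 1) + Q n := by
  let f : ℕ → (ℤ × ℕ) × (ℤ × ℕ) := fun n => Nat.rec ((p₀, q₀), (p₁, q₁))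
    (fun _ s => (s.2, (A s.2.2 * s.2.1 + s.1.1, A s.2.2 * s.2.2 + s.1.2))) n
  exact ⟨fun n => (f n).1.1, fun n => (f n).1.2, rfl, rfl, rfl, rfl, fun _ => rfl, fun _ => rfl⟩

lemma abs_sub_div_le_of_unimodular {ω : ℝ} {P P' : ℤ} {Q Q' : ℕ} (hQ : 1 ≤ Q) (hQ' : 1 ≤ Q')
    (hdet : (P' * Q - P * Q') ^ 2 = 1)
    (hsgn : ((Q : ℝ) * ω - P) * ((Q' : ℝ) * ω - P') ≤ 0) :
    |ω - P / Q| ≤ 1 / Q' := by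
  have h1 : (1 : ℝ) ≤ Q := by exact_mod_cast hQ
  have h2 : (1 : ℝ) ≤ Q' := by exact_mod_cast hQ'
  have hdet' : ((P' * Q - P * Q') ^ 2 : ℝ) = 1 := by exact_mod_cast hdet
  have h3 : |(ω - P / Q) * (Q * Q')| ≤ |1| := by
    refine sq_le_sq.1 ?_
    rw [show (ω - P / Q) * (Q * Q') = Q' * (Q * ω - P) by field_simp]
    have := mul_nonneg (by positivity : (0 : ℝ) ≤ Q * Q') (neg_nonneg.2 hsgn)
    nlinarith [sq_nonneg (Q * (Q' * ω - P'))]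
  rw [abs_mul, abs_one, abs_of_pos (by positivity : (0 : ℝ) < Q * Q')] at h3
  rw [le_div_iff₀ (by positivity)]
  have := mul_nonneg (abs_nonneg (ω - P / Q)) (by positivity : (0 : ℝ) ≤ Q')
  nlinarith

/-- Continuants with partial quotients at least two converge to an irrational number, whose best
denominators they eventually exhaust. -/
lemma exists_irrational_of_continuants {A : ℕ → ℕ} (hA : ∀ n, 2 ≤ A n) {P : ℕ → ℤ} {Q : ℕ → ℕ}
    (hQ0 : 1 ≤ Q 0) (hQ1 : Q 0 < Q 1) (hdet0 : (P 1 * Q 0 - P 0 * Q 1) ^ 2 = 1)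
    (hP : ∀ n, P (n + 2) = A (Q (n + 1)) * P (n + 1) + P n)
    (hQ : ∀ n, Q (n + 2) = A (Q (n + 1)) * Q (n + 1) + Q n) :
    ∃ ω : ℝ, Irrational ω ∧ |ω - P 0 / Q 0| ≤ 1 / Q 1 ∧
      ∃ (q m : ℕ → ℕ), BestDenSeq ω q ∧ StrictMono m ∧
        ∀ n, q (m n) = Q (n + 1) ∧ q (m n + 1) = Q (n + 2) := by
  have hQmono : StrictMono Q ∧ ∀ n, 1 ≤ Q n := by
    have : ∀ n, 1 ≤ Q n ∧ Q n < Q (n + 1) := by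
      intro n
      induction n with
      | zero => exact ⟨hQ0, hQ1⟩
      | succ n ih =>
        refine ⟨ih.1.trans ih.2.le, ?_⟩
        rw [hQ]
        nlinarith [hA (Q (n + 1))]
    exact ⟨strictMono_nat_of_lt_succ fun n => (this n).2, fun n => (this n).1⟩
  obtain ⟨hmono, hpos⟩ := hQmono
  have hdet : ∀ n, (P (n + 1) * Q n - P n * Q (n + 1)) ^ 2 = 1 := by
    intro n
    induction n with
    | zero => exact hdet0
    | succ n ih =>
      rw [hQ, hP]
      push_cast
      linear_combination ih
  let K : ℕ → Set ℝ := fun n => {x | ((Q n : ℝ) * x - P n) * ((Q (n + 1) : ℝ) * x - P (n + 1)) ≤ 0}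
  have hrec : ∀ (x : ℝ) n, (Q (n + 2) : ℝ) * x - P (n + 2) =
      A (Q (n + 1)) * (Q (n + 1) * x - P (n + 1)) + (Q n * x - P n) := by
    intro x n
    rw [hQ, hP]
    push_cast
    ring
  obtain ⟨ω, hω⟩ : (⋂ n, K n).Nonempty := by
    have hcl : ∀ n, IsClosed (K n) := fun n => isClosed_le (by fun_prop) (by fun_prop)
    refine IsCompact.nonempty_iInter_of_sequence_nonempty_isCompact_isClosed K ?_ ?_ ?_ hcl
    · intro n x hx
      simp only [K, Set.mem_ofPred_eq, hrec] at hx ⊢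
      have : (0 : ℝ) ≤ A (Q (n + 1)) := by positivity
      nlinarith [mul_nonneg this (sq_nonneg (Q (n + 1) * x - P (n + 1)))]
    · intro n
      refine ⟨P n / Q n, ?_⟩
      have : (Q n : ℝ) ≠ 0 := by exact_mod_cast Nat.one_le_iff_ne_zero.1 (hpos n)
      simp [K, mul_div_cancel₀ _ this]
    · refine (isCompact_closedBall ((P 0 : ℝ) / Q 0) (1 / Q 1)).of_isClosed_subset (hcl 0) ?_
      intro x hx
      rw [Metric.mem_closedBall, Real.dist_eq]
      exact abs_sub_div_le_of_unimodular (hpos 0) (hpos 1) hdet0 hx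
  have hsgn : ∀ n, ((Q n : ℝ) * ω - P n) * ((Q (n + 1) : ℝ) * ω - P (n + 1)) ≤ 0 :=
    fun n => Set.mem_iInter.1 hω n
  have hsq : ∀ n, ((Q (n + 2) : ℝ) * ω - P (n + 2)) ^ 2 + 4 * (Q (n + 1) * ω - P (n + 1)) ^ 2 ≤
      (Q n * ω - P n) ^ 2 := by
    intro n
    have h1 : (Q n : ℝ) * ω - P n = (Q (n + 2) * ω - P (n + 2)) -
        A (Q (n + 1)) * (Q (n + 1) * ω - P (n + 1)) := by rw [hrec]; ring
    have h2 : (2 : ℝ) ≤ A (Q (n + 1)) := by exact_mod_cast hA _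
    have h3 := mul_nonneg (by linarith : (0 : ℝ) ≤ A (Q (n + 1))) (neg_nonneg.2 (hsgn (n + 1)))
    have h4 : (4 : ℝ) ≤ (A (Q (n + 1)) : ℝ) ^ 2 := by nlinarith
    rw [h1]
    nlinarith [mul_le_mul_of_nonneg_right h4 (sq_nonneg ((Q (n + 1) : ℝ) * ω - P (n + 1)))]
  have hlt : ∀ n, |(Q (n + 1) : ℝ) * ω - P (n + 1)| < |(Q n : ℝ) * ω - P n| := by
    intro n
    refine sq_lt_sq.1 ?_
    have h1 := hsq n
    by_contra! hle
    have h2 : ((Q (n + 1) : ℝ) * ω - P (n + 1)) = 0 := by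
      refine pow_eq_zero_iff two_ne_zero |>.1 (le_antisymm ?_ (sq_nonneg _))
      nlinarith [sq_nonneg ((Q (n + 2) : ℝ) * ω - P (n + 2))]
    rw [h2] at hle
    have h3 : ((Q n : ℝ) * ω - P n) = 0 :=
      pow_eq_zero_iff two_ne_zero |>.1 (le_antisymm (by simpa using hle) (sq_nonneg _))
    have h4 : ((P (n + 1) * Q n - P n * Q (n + 1)) ^ 2 : ℝ) = 1 := by exact_mod_cast hdet n
    rw [show (P (n + 1) * Q n - P n * Q (n + 1) : ℝ) = 0 by
      linear_combination (Q (n + 1) : ℝ) * h3 - (Q n : ℝ) * h2] at h4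
    norm_num at h4
  have hmin : ∀ n k, 1 ≤ k → k < Q (n + 1) →
      |(Q n : ℝ) * ω - P n| ≤ |(k : ℝ) * ω - round ((k : ℝ) * ω)| := fun n k hk hkQ =>
    abs_le_of_unimodular (hpos n) (hdet n) (hsgn n) hk hkQ
  have hbest : ∀ n, IsBestDen ω (Q (n + 1)) := fun n => ⟨hpos _, fun k hk hkQ =>
    (round_le _ _).trans_lt ((hlt n).trans_le (hmin n k hk hkQ))⟩
  have hinf : (Set.ofPred (IsBestDen ω)).Infinite := by
    refine Set.infinite_of_not_bddAbove ?_
    rintro ⟨B, hB⟩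
    have h1 := hB (hbest B)
    have h2 := hmono.id_le (B + 1)
    simp only [id] at h2
    omega
  classical
  let m : ℕ → ℕ := fun n => Nat.count (IsBestDen ω) (Q (n + 1))
  have hm : ∀ n, Nat.nth (IsBestDen ω) (m n) = Q (n + 1) := fun n => Nat.nth_count (hbest n)
  have hnth := Nat.nth_strictMono hinf
  have hmlt : ∀ n, m n < m (n + 1) := fun n => by
    rw [← hnth.lt_iff_lt, hm, hm]
    exact hmono (Nat.lt_succ_self _)
  refine ⟨ω, irrational_of_isBestDen fun N => ⟨Q (N + 1), hmono.id_le _, hbest N⟩,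
    abs_sub_div_le_of_unimodular (hpos 0) (hpos 1) hdet0 (hsgn 0),
    Nat.nth (IsBestDen ω), m, ⟨hnth, Nat.nth_mem_of_infinite hinf, ?_⟩,
    strictMono_nat_of_lt_succ hmlt, fun n => ⟨hm n, ?_⟩⟩
  · intro k hk
    exact ⟨_, Nat.nth_count hk⟩
  · rw [← hm (n + 1)]
    congr 1
    refine eq_of_le_of_not_lt (hmlt n : m n + 1 ≤ m (n + 1)) fun hlt' => ?_
    have h1 := hnth hlt'
    have h2 := hnth (Nat.lt_succ_self (m n))
    rw [hm] at h1 h2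
    exact IsBestDen.not_of_abs_le (hpos _) h2
      ((round_le _ _).trans (hmin (n + 1) _ ((hpos _).trans h2.le) h1))
      (Nat.nth_mem_of_infinite hinf _)

lemma MemH.exists_le_mul {h : ℝ → ℝ} (hH : MemH h) :
    ∃ C : ℝ, 1 ≤ C ∧ ∀ x : ℝ, 1 ≤ x → h x ≤ C * x := by
  obtain ⟨hpos, hmono, hlim⟩ := hH
  obtain ⟨X, hX⟩ := Filter.eventually_atTop.1 (hlim.eventually_le_const one_pos)
  refine ⟨max 1 (h (max X 1)), le_max_left _ _, fun x hx => ?_⟩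
  rcases le_total X x with hXx | hXx
  · have h1 := (div_le_one (by linarith)).1 (hX x hXx)
    nlinarith [le_max_left 1 (h (max X 1))]
  · have h1 : h x ≤ h (max X 1) := hmono.monotoneOn
      (show (0 : ℝ) < x by linarith) (show (0 : ℝ) < max X 1 by positivity)
      (hXx.trans (le_max_left _ _))
    nlinarith [le_max_left 1 (h (max X 1)), le_max_right 1 (h (max X 1))]

lemma condA_of_continuants {h : ℝ → ℝ} (hH : MemH h) {ω : ℝ} {q m : ℕ → ℕ} {a : ℕ → ℝ}
    (hq : BestDenSeq ω q) (hm : StrictMono m) (hstep : ∀ n, m (n + 1) = m n + 1)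
    (ha : ∀ n, 2 ≤ a n ∧ h (q (m n)) ≤ a n ∧ a n ≤ h (q (m n)) + 3)
    (hlow : ∀ n, a n * q (m n) < q (m n + 1))
    (hup : ∀ n, (q (m n + 1) : ℝ) ≤ (a n + 1) * q (m n)) : CondA ω h := by
  obtain ⟨C, hC, hhC⟩ := hH.exists_le_mul
  have hpos := hH.1
  have hq1 : ∀ n, (1 : ℝ) ≤ q n := fun n => by exact_mod_cast (hq.2.1 n).1
  have hqh : ∀ n, 0 < h (q n) := fun n => hpos _ (by linarith [hq1 n])
  have hL : 0 ≤ Real.log (C * (4 + C) ^ 2) := Real.log_nonneg (by nlinarith)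
  refine ⟨Real.log (C * (4 + C) ^ 2) + 5, by linarith, q, hq, m, 2 / 3, hm, by norm_num,
    by norm_num, fun n => ?_, id, fun n => ⟨?_, ?_⟩⟩
  · refine lt_of_le_of_lt ?_ (hlow n)
    nlinarith [hq1 (m n), (ha n).2.1]
  · simp only [id, hstep]
    have h1 := hq1 (m n)
    have h2 := hqh (m n)
    rw [one_div, inv_mul_eq_div, ← Real.log_mul (by positivity) (by norm_num)]
    refine div_lt_div_of_pos_right (Real.log_lt_log (by positivity) ?_) (by linarith)
    have h3 : 2 * (q (m n) : ℝ) < q (m n + 1) :=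
      lt_of_le_of_lt (by nlinarith [(ha n).1]) (hlow n)
    have h4 : h (q (m n)) ≤ h (q (m n + 1)) := hH.2.1.monotoneOn
      (Set.mem_Ioi.2 (by linarith)) (Set.mem_Ioi.2 (by linarith)) (by linarith)
    calc (q (m n) : ℝ) * h (q (m n)) * (2 / 3)⁻¹ < 2 * q (m n) * h (q (m n)) := by
          nlinarith [mul_pos (show (0 : ℝ) < q (m n) by linarith) h2]
      _ ≤ q (m n + 1) * h (q (m n + 1)) := by gcongr
  · simp only [id, hstep]
    set x : ℝ := (q (m n) : ℝ)
    set y : ℝ := (q (m n + 1) : ℝ)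
    have hx : 1 ≤ x := hq1 _
    have hy : 1 ≤ y := hq1 _
    have hyx : y ≤ (4 + C) * x ^ 2 := by
      have h1 : a n + 1 ≤ (4 + C) * x := by nlinarith [hhC x hx, (ha n).2.2]
      calc y ≤ (a n + 1) * x := hup n
        _ ≤ (4 + C) * x * x := by gcongr
        _ = _ := by ring
    have h2 : y * h y ≤ C * (4 + C) ^ 2 * x ^ 4 := by
      calc y * h y ≤ y * (C * y) := by gcongr; exact hhC y hy
        _ = C * y ^ 2 := by ring
        _ ≤ C * ((4 + C) * x ^ 2) ^ 2 := by gcongr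
        _ = _ := by ring
    have h3 : Real.log (y * h y) ≤ Real.log (C * (4 + C) ^ 2) + 4 * x := by
      refine (Real.log_le_log (mul_pos (by linarith) (hqh _)) h2).trans ?_
      rw [Real.log_mul (by positivity) (by positivity), Real.log_pow]
      have := Real.log_le_sub_one_of_pos (show 0 < x by linarith)
      push_cast
      linarith
    rw [div_lt_iff₀ (by linarith)]
    nlinarith

lemma exists_unimodular_neighbor (r : ℚ) (N : ℕ) :
    ∃ (p : ℤ) (q : ℕ), N ≤ q ∧ p * r.den - r.num * q = 1 := by
  obtain ⟨u, v, huv⟩ : IsCoprime (r.den : ℤ) r.num :=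
    (Int.isCoprime_iff_gcd_eq_one.2 (by simpa [Int.gcd] using r.reduced)).symm
  have hd : (1 : ℤ) ≤ r.den := by exact_mod_cast r.pos
  have hnn : (N : ℤ) ≤ -v + (|v| + N) * r.den := by
    nlinarith [neg_abs_le v, le_abs_self v, mul_nonneg (abs_nonneg v) (sub_nonneg.2 hd),
      mul_nonneg (Int.natCast_nonneg N) (sub_nonneg.2 hd)]
  obtain ⟨q, hq⟩ := Int.eq_ofNat_of_zero_le ((Int.natCast_nonneg N).trans hnn)
  refine ⟨u + (|v| + N) * r.num, q, by omega, ?_⟩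
  rw [← hq]
  linear_combination huv

lemma exists_condA_near {h : ℝ → ℝ} (hH : MemH h) (r : ℚ) {ε : ℝ} (hε : 0 < ε) :
    ∃ ω : ℝ, |ω - r| < ε ∧ Irrational ω ∧ CondA ω h := by
  obtain ⟨N, hN⟩ := exists_nat_one_div_lt hε
  obtain ⟨p, q₁, hq₁, hdet⟩ := exists_unimodular_neighbor r (r.den + N + 1)
  obtain ⟨P, Q, hP0, hP1, hQ0, hQ1, hP, hQ⟩ :=
    exists_continuants (fun n => max 2 ⌈h n⌉₊) r.num p r.den q₁
  obtain ⟨ω, hirr, hclose, q, m, hq, hm, hqm⟩ := exists_irrational_of_continuants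
    (A := fun n => max 2 ⌈h n⌉₊) (fun n => le_max_left _ _) (hQ0 ▸ r.pos)
    (by rw [hQ0, hQ1]; omega) (by rw [hQ0, hQ1, hP0, hP1, hdet]; norm_num) hP hQ
  refine ⟨ω, ?_, hirr, ?_⟩
  · rw [hP0, hQ0, hQ1, ← Rat.cast_def] at hclose
    refine hclose.trans_lt (lt_of_le_of_lt ?_ hN)
    refine one_div_le_one_div_of_le (by positivity) ?_
    exact_mod_cast (by omega : N + 1 ≤ q₁)
  · have hQpos : ∀ n, 1 ≤ Q (n + 1) := fun n => (hqm n).1 ▸ (hq.2.1 _).1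
    have hQle : ∀ n, 1 ≤ Q n ∧ Q n ≤ Q (n + 1)
      | 0 => ⟨hQ0 ▸ r.pos, by rw [hQ0, hQ1]; omega⟩
      | n + 1 => ⟨hQpos n, by
          rw [← (hqm n).1, show n + 1 + 1 = n + 2 from rfl, ← (hqm n).2]
          exact (hq.1 (Nat.lt_succ_self _)).le⟩
    refine condA_of_continuants hH (a := fun n => ((max 2 ⌈h (Q (n + 1))⌉₊ : ℕ) : ℝ)) hq hm
      (fun n => hq.1.injective ?_) (fun n => ⟨?_, ?_, ?_⟩) (fun n => ?_) (fun n => ?_)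
    · rw [(hqm (n + 1)).1, (hqm n).2]
    · exact_mod_cast le_max_left _ _
    · rw [(hqm n).1]
      exact (Nat.le_ceil _).trans (by exact_mod_cast le_max_right _ _)
    · rw [(hqm n).1]
      have h0 : 0 < h (Q (n + 1)) := hH.1 _ (by exact_mod_cast hQpos n)
      push_cast
      refine max_le (by linarith) ?_
      linarith [Nat.ceil_lt_add_one h0.le]
    · rw [(hqm n).1, (hqm n).2, hQ n]
      exact_mod_cast Nat.lt_add_of_pos_right (hQle n).1
    · rw [(hqm n).1, (hqm n).2, hQ n]
      have : (Q n : ℝ) ≤ Q (n + 1) := by exact_mod_cast (hQle n).2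
      push_cast
      linarith

/-- if `h ∈ ℋ` and `Σ 1/h(2^{(n−1)/2})` converges, then the set of
`ω ∈ (0,1)` satisfying condition (A) with `h` has Lebesgue measure zero; nevertheless,
for every `h ∈ ℋ` this set is dense in `(0,1)`. -/
theorem stmt16 (h : ℝ → ℝ) (hH : MemH h) :
    ((Summable fun n : ℕ => 1 / h ((2 : ℝ) ^ (((n : ℝ) - 1) / 2))) →
      volume {ω ∈ Set.Ioo (0 : ℝ) 1 | Irrational ω ∧ CondA ω h} = 0) ∧
    Set.Ioo (0 : ℝ) 1 ⊆
      closure {ω ∈ Set.Ioo (0 : ℝ) 1 | Irrational ω ∧ CondA ω h} := by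
  refine ⟨volume_condA_eq_zero hH.1 hH.2.1, fun x hx => mem_closure_iff.2 fun o ho hxo => ?_⟩
  have hU : IsOpen (o ∩ Set.Ioo (0 : ℝ) 1) := ho.inter isOpen_Ioo
  obtain ⟨r, hr⟩ := Rat.denseRange_cast.exists_mem_open hU ⟨x, hxo, hx⟩
  obtain ⟨ε, hε, hball⟩ := Metric.isOpen_iff.1 hU _ hr
  obtain ⟨ω, hω, hirr, hA⟩ := exists_condA_near hH r hε
  have hmem := hball (show ω ∈ Metric.ball (r : ℝ) ε from hω)
  exact ⟨ω, hmem.1, hmem.2, hirr, hA⟩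
end
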